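/- There exist universal constants κ ≥ 1 and c > 0 (independent of d, N, p and of the words) such that for all integers d, N ≥ 1 and every sparsity parameter p ∈ (0,1] with N·p ≥ 1, and for all words I, J over {1,…,d}, the sparse random model satisfies ( E[ ( (1/N)⟨A_I h₀, A_J h₀⟩ − δ_{I,J} )² ] )^{1/2} ≤ (κ(|I|+|J|))!! · c/√(Np). -/

import Mathlib

open MeasureTheory ProbabilityTheory Matrix

noncomputable section

/-- Ordered product of the matrices `A i` along the word `I`
(the identity matrix for the empty word). -/
def wordProd {d : ℕ} {n : Type*} [Fintype n] [DecidableEq n]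
    (A : Fin d → Matrix n n ℝ) (I : List (Fin d)) : Matrix n n ℝ :=
  (I.map A).prod

/-- Kronecker delta of two words: `1` if `I = J`, `0` otherwise. -/
def wordDelta {d : ℕ} (I J : List (Fin d)) : ℝ := if I = J then 1 else 0

/-- The Bernoulli(p) distribution on `ℝ`: mass `p` at `1` and mass `1 - p` at `0`. -/
def bernoulliReal (p : ℝ) : Measure ℝ :=
  (Real.toNNReal p) • Measure.dirac 1 + (Real.toNNReal (1 - p)) • Measure.dirac 0

/-- Sample space of the sparse random model: the Gaussian matrices `W^i`, the Bernoulli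
masking matrices `B^i`, and the initial vector `h₀ ∈ ℝ^N`. -/
abbrev SparseOmega (d N : ℕ) : Type :=
  (Fin d → Fin N → Fin N → ℝ) × (Fin d → Fin N → Fin N → ℝ) × (Fin N → ℝ)

/-- The probability measure of the sparse random model: all entries of the `W^i` are
i.i.d. standard Gaussians, all entries of the `B^i` are i.i.d. Bernoulli(p), the entries
of `h₀` are i.i.d. standard Gaussians, and all of these are mutually independent. -/
def sparseMeasure (d N : ℕ) (p : ℝ) : Measure (SparseOmega d N) :=
  (Measure.pi fun _ : Fin d => Measure.pi fun _ : Fin N => Measure.pi fun _ : Fin N =>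
      gaussianReal 0 1).prod
    ((Measure.pi fun _ : Fin d => Measure.pi fun _ : Fin N => Measure.pi fun _ : Fin N =>
        bernoulliReal p).prod
      (Measure.pi fun _ : Fin N => gaussianReal 0 1))

/-- The channel matrices of the sparse model: `A^i = (1/√(Np)) W^i ⊙ B^i`,
where `⊙` is the entrywise (Hadamard) product. -/
def sparseA {d N : ℕ} (p : ℝ) (ω : SparseOmega d N) (i : Fin d) :
    Matrix (Fin N) (Fin N) ℝ :=
  (Real.sqrt (N * p))⁻¹ • (Matrix.of (ω.1 i) ⊙ Matrix.of (ω.2.1 i))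

/-- The random feature `A_I h₀` associated to a word `I`. -/
def sparseFeature {d N : ℕ} (p : ℝ) (I : List (Fin d)) (ω : SparseOmega d N) :
    Fin N → ℝ :=
  (wordProd (sparseA p ω) I).mulVec ω.2.2

/-- The `k`-th moment of the standard Gaussian distribution. -/
def gaussianMoment (k : ℕ) : ℝ := ∫ x, x ^ k ∂gaussianReal 0 1

/-- The `k`-th moment of the Bernoulli(p) distribution. -/
def bernoulliMoment (p : ℝ) (k : ℕ) : ℝ := if k = 0 then 1 else p

lemma integrable_pow_gaussianReal (k : ℕ) : Integrable (fun x : ℝ => x ^ k) (gaussianReal 0 1) := by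
  have h : MemLp (id : ℝ → ℝ) k (gaussianReal 0 1) := by
    simpa using memLp_id_gaussianReal (μ := 0) (v := 1) (k : NNReal)
  rw [← integrable_norm_iff (by fun_prop)]
  simpa using h.integrable_norm_pow'

lemma gaussianMoment_zero : gaussianMoment 0 = 1 := by simp [gaussianMoment]

lemma gaussianMoment_two : gaussianMoment 2 = 1 := by
  have h := variance_id_gaussianReal (μ := 0) (v := 1)
  rw [variance_eq_sub (memLp_id_gaussianReal' 2 (by simp))] at h
  simpa [gaussianMoment] using h

lemma gaussianMoment_odd {k : ℕ} (hk : Odd k) : gaussianMoment k = 0 := by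
  have h : gaussianMoment k = -gaussianMoment k := by
    unfold gaussianMoment
    have hmap := gaussianReal_map_neg (μ := 0) (v := 1)
    rw [neg_zero] at hmap
    conv_lhs => rw [← hmap]
    rw [integral_map (by fun_prop) (by fun_prop), ← integral_neg]
    simp [hk.neg_pow]
  linarith

lemma one_le_gaussianMoment {k : ℕ} (hk : Even k) : 1 ≤ gaussianMoment k := by
  obtain ⟨m, rfl⟩ := hk
  have hle : ∀ x : ℝ, 1 + m * (x ^ 2 - 1) ≤ x ^ (m + m) := fun x => by
    have h := one_add_mul_le_pow (a := x ^ 2 - 1) (by nlinarith [sq_nonneg x]) m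
    rw [← two_mul, pow_mul]
    simpa using h
  have h2 := integrable_pow_gaussianReal 2
  have h2' : Integrable (fun x : ℝ => m * (x ^ 2 - 1)) (gaussianReal 0 1) :=
    (h2.sub (integrable_const _)).const_mul _
  calc (1 : ℝ) = ∫ x : ℝ, (1 + m * (x ^ 2 - 1)) ∂gaussianReal 0 1 := by
        rw [integral_add (integrable_const _) h2', integral_const_mul,
          integral_sub h2 (integrable_const _)]
        simp [show ∫ x : ℝ, x ^ 2 ∂gaussianReal 0 1 = 1 from gaussianMoment_two]
    _ ≤ _ := integral_mono ((integrable_const _).add h2')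
        (integrable_pow_gaussianReal _) hle

lemma gaussianMoment_nonneg (k : ℕ) : 0 ≤ gaussianMoment k := by
  rcases Nat.even_or_odd k with h | h
  · linarith [one_le_gaussianMoment h]
  · rw [gaussianMoment_odd h]

lemma pow_two_mul_le_factorial_mul_cosh {m : ℕ} (hm : m ≠ 0) (x : ℝ) :
    x ^ (2 * m) ≤ (2 * m).factorial * (Real.cosh x - 1) := by
  have h := sum_le_hasSum {0, m} (fun i _ => by
    rw [pow_mul]; positivity) (Real.hasSum_cosh x)
  rw [Finset.sum_pair hm.symm] at h
  have hf : (0 : ℝ) < (2 * m).factorial := by positivity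
  rw [← div_le_iff₀' hf]
  simp at h
  linarith

lemma gaussianMoment_le_factorial (k : ℕ) : gaussianMoment k ≤ k.factorial := by
  rcases Nat.even_or_odd' k with ⟨m, rfl | rfl⟩
  · rcases eq_or_ne m 0 with rfl | hm
    · simp [gaussianMoment_zero]
    have hi (t : ℝ) : Integrable (fun x : ℝ => Real.exp (t * x)) (gaussianReal 0 1) :=
      integrable_exp_mul_gaussianReal t
    have hint (t : ℝ) : ∫ x, Real.exp (t * x) ∂gaussianReal 0 1 = Real.exp (t ^ 2 / 2) := by
      have h := congrFun (mgf_fun_id_gaussianReal (μ := 0) (v := 1)) t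
      simpa [mgf] using h
    have hc : (fun x => Real.cosh x) =
        fun x : ℝ => (Real.exp (1 * x) + Real.exp (-1 * x)) / 2 := by
      ext x; simp [Real.cosh_eq]
    have hci : Integrable (fun x => Real.cosh x) (gaussianReal 0 1) := by
      rw [hc]; exact ((hi 1).add (hi (-1))).div_const 2
    have hcv : ∫ x, Real.cosh x ∂gaussianReal 0 1 = Real.exp (1 / 2) := by
      rw [hc, integral_div, integral_add (hi 1) (hi (-1)), hint, hint]
      norm_num
    have he : Real.exp (1 / 2) ≤ 2 := by
      have h1 : Real.exp (1 / 2) ^ 2 = Real.exp 1 := by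
        rw [← Real.exp_nat_mul]; norm_num
      nlinarith [Real.exp_one_lt_d9, Real.exp_pos (1 / 2)]
    calc gaussianMoment (2 * m)
        ≤ ∫ x, (2 * m).factorial * (Real.cosh x - 1) ∂gaussianReal 0 1 :=
          integral_mono (integrable_pow_gaussianReal _)
            ((hci.sub (integrable_const _)).const_mul _)
            (pow_two_mul_le_factorial_mul_cosh hm)
      _ = (2 * m).factorial * (Real.exp (1 / 2) - 1) := by
          rw [integral_const_mul, integral_sub hci (integrable_const _), hcv]; simp
      _ ≤ (2 * m).factorial * 1 := by gcongr; linarith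
      _ = _ := mul_one _
  · rw [gaussianMoment_odd ⟨m, rfl⟩]; positivity

lemma isProbabilityMeasure_bernoulliReal {p : ℝ} (hp : 0 ≤ p) (hp' : p ≤ 1) :
    IsProbabilityMeasure (bernoulliReal p) := by
  refine ⟨?_⟩
  simp only [bernoulliReal, Measure.add_apply, Measure.smul_apply, measure_univ]
  rw [ENNReal.smul_def, ENNReal.smul_def, smul_eq_mul, smul_eq_mul, mul_one, mul_one,
    ← ENNReal.coe_add, ← Real.toNNReal_add hp (by linarith)]
  simp

lemma integrable_pow_bernoulliReal (p : ℝ) (k : ℕ) :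
    Integrable (fun x : ℝ => x ^ k) (bernoulliReal p) := by
  refine Integrable.add_measure ?_ ?_ <;>
    exact (integrable_dirac (by simp)).smul_measure_nnreal

lemma integral_pow_bernoulliReal {p : ℝ} (hp : 0 ≤ p) (hp' : p ≤ 1) (k : ℕ) :
    ∫ x, x ^ k ∂bernoulliReal p = bernoulliMoment p k := by
  have h (c : NNReal) (a : ℝ) : Integrable (fun x : ℝ => x ^ k) (c • Measure.dirac a) :=
    (integrable_dirac (by simp)).smul_measure_nnreal
  rw [bernoulliReal, integral_add_measure (h _ _) (h _ _), integral_smul_nnreal_measure,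
    integral_smul_nnreal_measure, integral_dirac, integral_dirac, bernoulliMoment]
  simp only [NNReal.smul_def, Real.coe_toNNReal _ hp, Real.coe_toNNReal _ (sub_nonneg.2 hp')]
  rcases eq_or_ne k 0 with rfl | hk <;> simp [*]

section Walk

variable {V E : Type*} {u : ℕ → V} {ε : ℕ → E} {L : ℕ}

/-- The edge labels of the walk determine the endpoints of each of its first `L` steps. -/
def EdgeCompatible (u : ℕ → V) (ε : ℕ → E) (L : ℕ) : Prop :=
  ∀ k < L, ∀ k' < L, ε k = ε k' → s(u k, u (k + 1)) = s(u k', u (k' + 1))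

/-- An edge reused right after discovering a vertex is the edge just traversed. -/
lemma EdgeCompatible.eq_pred_of_fresh (hcomp : EdgeCompatible u ε L) {k k' : ℕ}
    (hk : k < L) (hk' : k' < k) (he : ε k' = ε k) (hfresh : ∀ i < k, u i ≠ u k) :
    k' + 1 = k := by
  have := hcomp k' (hk'.trans hk) k hk he
  rw [Sym2.eq_iff] at this
  have h1 := hfresh k' hk'
  by_contra hne
  have h2 := hfresh (k' + 1) (by lia)
  tauto

variable [DecidableEq V] [DecidableEq E]

/-- The number of times the edge `e` is used in the first `L` steps. -/
def edgeCount (ε : ℕ → E) (L : ℕ) (e : E) : ℕ := ((Finset.range L).filter (ε · = e)).card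

/-- Step `k` either reuses an edge or discovers a new vertex. -/
def ReusesOrDiscovers (u : ℕ → V) (ε : ℕ → E) (k : ℕ) : Prop :=
  (∃ k' < k, ε k' = ε k) ∨ ∀ k' ≤ k, u k' ≠ u (k + 1)

lemma card_image_step (h : EdgeCompatible u ε L) {k : ℕ} (hk : k < L) :
    ((Finset.range (k + 2)).image u).card + ((Finset.range k).image ε).card
        ≤ ((Finset.range (k + 1)).image u).card + ((Finset.range (k + 1)).image ε).card ∧
      (¬ ReusesOrDiscovers u ε k →
        ((Finset.range (k + 2)).image u).card + ((Finset.range k).image ε).card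
          < ((Finset.range (k + 1)).image u).card + ((Finset.range (k + 1)).image ε).card) := by
  have key : (∃ k' < k, ε k' = ε k) → ∃ k' ≤ k, u k' = u (k + 1) := by
    rintro ⟨k', hk', he⟩
    have := h k' (hk'.trans hk) k hk he
    rw [Sym2.eq_iff] at this
    rcases this with ⟨-, h2⟩ | ⟨h1, -⟩
    · exact ⟨k' + 1, hk', h2⟩
    · exact ⟨k', hk'.le, h1⟩
  rw [Finset.range_add_one (n := k + 1), Finset.image_insert,
    Finset.card_insert_eq_ite, Finset.range_add_one (n := k), Finset.image_insert (f := ε),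
    Finset.card_insert_eq_ite, ← Finset.range_add_one]
  have h1 : u (k + 1) ∈ (Finset.range (k + 1)).image u ↔ ∃ k' ≤ k, u k' = u (k + 1) := by
    simp
  have h2 : ε k ∈ (Finset.range k).image ε ↔ ∃ k' < k, ε k' = ε k := by simp
  simp only [h1, h2, ReusesOrDiscovers]
  by_cases c1 : ∃ k' < k, ε k' = ε k
  · have c2 := key c1
    simp [c1, c2]
  · by_cases c2 : ∃ k' ≤ k, u k' = u (k + 1)
    · rw [if_pos c2, if_neg c1]
      exact ⟨by lia, fun _ => by lia⟩
    · rw [if_neg c2, if_neg c1]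
      refine ⟨by lia, fun hn => absurd (Or.inr fun k' hk' he => c2 ⟨k', hk', he⟩) hn⟩

/-- A walk sees at most one more vertex than it uses edges. -/
lemma card_image_mono (h : EdgeCompatible u ε L) {i j : ℕ} (hij : i ≤ j) (hj : j ≤ L) :
    ((Finset.range (j + 1)).image u).card + ((Finset.range i).image ε).card
        ≤ ((Finset.range (i + 1)).image u).card + ((Finset.range j).image ε).card := by
  induction j, hij using Nat.le_induction with
  | base => rfl
  | succ j hij ih =>
    have := ih (by lia)
    have := (card_image_step h (k := j) hj).1
    rw [show j + 1 + 1 = j + 2 from rfl]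
    lia

lemma card_image_le (h : EdgeCompatible u ε L) :
    ((Finset.range (L + 1)).image u).card ≤ ((Finset.range L).image ε).card + 1 := by
  have := card_image_mono h (Nat.zero_le L) le_rfl
  simp at this
  lia

/-- In the extremal case, each step reuses an edge or discovers a vertex. -/
lemma reusesOrDiscovers_of_card (h : EdgeCompatible u ε L)
    (hc : ((Finset.range L).image ε).card + 1 ≤ ((Finset.range (L + 1)).image u).card)
    {k : ℕ} (hk : k < L) : ReusesOrDiscovers u ε k := by
  by_contra hn
  have h1 := (card_image_step h hk).2 hn
  have h2 := card_image_mono h (Nat.zero_le k) hk.le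
  have h3 := card_image_mono h (Nat.succ_le_of_lt hk) le_rfl
  simp only [Nat.succ_eq_add_one, show k + 1 + 1 = k + 2 from rfl] at h3
  simp at h2
  lia

lemma edgeCount_pos_iff {e : E} : 0 < edgeCount ε L e ↔ e ∈ (Finset.range L).image ε := by
  simp [edgeCount, Finset.card_pos, Finset.Nonempty]

lemma two_mul_card_image_le (h : ∀ e, Even (edgeCount ε L e)) :
    2 * ((Finset.range L).image ε).card ≤ L := by
  have := Finset.mul_card_image_le_card (f := ε) (s := Finset.range L) 2 (fun e he => by
    have h1 := edgeCount_pos_iff.2 he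
    obtain ⟨r, hr⟩ := h e
    change 2 ≤ edgeCount ε L e
    lia)
  simpa using this

lemma edgeCount_eq_two (h : ∀ e, Even (edgeCount ε L e))
    (hc : L ≤ 2 * ((Finset.range L).image ε).card) {e : E} (he : 0 < edgeCount ε L e) :
    edgeCount ε L e = 2 := by
  have hs : ∑ e ∈ (Finset.range L).image ε, edgeCount ε L e = L := by
    have := Finset.card_eq_sum_card_image ε (Finset.range L)
    rw [Finset.card_range] at this
    exact this.symm
  have hge : ∀ e ∈ (Finset.range L).image ε, 2 ≤ edgeCount ε L e := fun e he => by
    have h1 := edgeCount_pos_iff.2 he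
    obtain ⟨r, hr⟩ := h e
    lia
  have hle : ∑ e ∈ (Finset.range L).image ε, 2 =
      ∑ e ∈ (Finset.range L).image ε, edgeCount ε L e := by
    refine le_antisymm (Finset.sum_le_sum hge) ?_
    rw [hs, Finset.sum_const, smul_eq_mul]; lia
  exact ((Finset.sum_eq_sum_iff_of_le hge).1 hle e (edgeCount_pos_iff.1 he)).symm

end Walk

section Ladder

variable {D V : Type*} {u : ℕ → Option V} {ε : ℕ → (D × V × V) ⊕ V} {L c l m : ℕ}
  {I J : ℕ → D} {x y : ℕ → V}

/-- From time `c` on, the walk `(u, ε)` leaves the root `none` for `x l`, descends along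
`x l, …, x 0 = y 0`, ascends along `y 0, …, y m`, and returns to the root. -/
structure IsChainAt (u : ℕ → Option V) (ε : ℕ → (D × V × V) ⊕ V) (c l m : ℕ)
    (I J : ℕ → D) (x y : ℕ → V) : Prop where
  start : u c = none
  down : ∀ a b, a + b = l → u (c + 1 + a) = some (x b)
  up : ∀ j ≤ m, u (c + l + 1 + j) = some (y j)
  finish : u (c + l + m + 2) = none
  edge_start : ε c = Sum.inr (x l)
  edge_down : ∀ a b, a + b + 1 = l → ε (c + 1 + a) = Sum.inl (I b, x b, x (b + 1))
  edge_up : ∀ j < m, ε (c + l + 1 + j) = Sum.inl (J j, y j, y (j + 1))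
  edge_finish : ε (c + l + m + 1) = Sum.inr (y m)

namespace IsChainAt

lemma down_fresh (hch : IsChainAt u ε c l m I J x y) (hL : c + l + m + 2 ≤ L)
    (hcomp : EdgeCompatible u ε L) (hrd : ∀ k < L, ReusesOrDiscovers u ε k)
    (hnew : ∀ k < c, ε k ≠ Sum.inr (x l))
    (a : ℕ) (ha : a ≤ l) : ∀ i < c + 1 + a, u i ≠ u (c + 1 + a) := by
  induction a with
  | zero =>
    rcases hrd c (by lia) with ⟨k', hk', he⟩ | h
    · exact absurd (he.trans hch.edge_start) (hnew k' hk')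
    · exact fun i hi => h i (by lia)
  | succ a ih =>
    have ih := ih (by lia)
    rcases hrd (c + 1 + a) (by lia) with ⟨k', hk', he⟩ | h
    · exfalso
      have h1 := hcomp.eq_pred_of_fresh (by lia) hk' he ih
      obtain ⟨b, hb⟩ : ∃ b, a + b + 1 = l := ⟨l - a - 1, by lia⟩
      rw [hch.edge_down a b hb] at he
      rcases a with _ | a
      · obtain rfl : k' = c := by lia
        rw [hch.edge_start] at he
        simp at he
      · obtain rfl : k' = c + 1 + a := by lia
        rw [hch.edge_down a (b + 1) (by lia)] at he
        simp only [Sum.inl.injEq, Prod.mk.injEq] at he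
        refine ih (c + 1 + a) (by lia) ?_
        rw [hch.down a (b + 2) (by lia), hch.down (a + 1) (b + 1) (by lia), ← he.2.2]
    · exact fun i hi => h i (by lia)

lemma down_injective (hch : IsChainAt u ε c l m I J x y) (hL : c + l + m + 2 ≤ L)
    (hcomp : EdgeCompatible u ε L) (hrd : ∀ k < L, ReusesOrDiscovers u ε k)
    (hnew : ∀ k < c, ε k ≠ Sum.inr (x l))
    {i j : ℕ} (hi : i ≤ l) (hj : j ≤ l) (h : x i = x j) : i = j := by
  wlog hij : i < j generalizing i j
  · rcases Nat.lt_or_ge j i with h' | h'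
    · exact (this hj hi h.symm h').symm
    · lia
  exfalso
  refine hch.down_fresh hL hcomp hrd hnew (l - i) (by lia) (c + 1 + (l - j)) (by lia) ?_
  rw [hch.down _ j (by lia), hch.down _ i (by lia), h]

lemma up_not_fresh (hch : IsChainAt u ε c l m I J x y) (hL : c + l + m + 2 ≤ L)
    (hcomp : EdgeCompatible u ε L) (hrd : ∀ k < L, ReusesOrDiscovers u ε k)
    (r j : ℕ) (hj : j + r + 1 = m)
    (hfresh : ∀ i < c + l + 1 + (j + 1), u i ≠ u (c + l + 1 + (j + 1))) : False := by
  induction r generalizing j with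
  | zero =>
    obtain rfl : j + 1 = m := by lia
    rcases hrd (c + l + 1 + (j + 1)) (by lia) with ⟨k', hk', he⟩ | h
    · have h1 := hcomp.eq_pred_of_fresh (by lia) hk' he hfresh
      obtain rfl : k' = c + l + 1 + j := by lia
      rw [hch.edge_up j (by lia), show c + l + 1 + (j + 1) = c + l + (j + 1) + 1 by lia,
        hch.edge_finish] at he
      simp at he
    · refine h c (by lia) ?_
      rw [hch.start, show c + l + 1 + (j + 1) + 1 = c + l + (j + 1) + 2 by lia, hch.finish]
  | succ r ih =>
    rcases hrd (c + l + 1 + (j + 1)) (by lia) with ⟨k', hk', he⟩ | h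
    · have h1 := hcomp.eq_pred_of_fresh (by lia) hk' he hfresh
      obtain rfl : k' = c + l + 1 + j := by lia
      rw [hch.edge_up j (by lia), hch.edge_up (j + 1) (by lia)] at he
      simp only [Sum.inl.injEq, Prod.mk.injEq] at he
      refine hfresh (c + l + 1 + j) (by lia) ?_
      rw [hch.up j (by lia), hch.up (j + 1) (by lia), he.2.1]
    · exact ih (j + 1) (by lia) fun i hi => h i (by lia)

lemma up_eq_down (hch : IsChainAt u ε c l m I J x y) (hL : c + l + m + 2 ≤ L)
    (hcomp : EdgeCompatible u ε L) (hrd : ∀ k < L, ReusesOrDiscovers u ε k)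
    (hnew : ∀ k < c, ε k ≠ Sum.inr (x l))
    (j : ℕ) (hj : j ≤ m) :
    j ≤ l ∧ (∀ i < j, J i = I i) ∧ ∀ i ≤ j, y i = x i := by
  have hfr := hch.down_fresh hL hcomp hrd hnew
  induction j with
  | zero =>
    refine ⟨by lia, by simp, fun i hi => ?_⟩
    obtain rfl : i = 0 := by lia
    have h1 := hch.down l 0 (by lia)
    have h2 := hch.up 0 (by lia)
    rw [show c + l + 1 + 0 = c + 1 + l by lia, h1] at h2
    simpa using h2.symm
  | succ j ih =>
    obtain ⟨hjl, hI, hx⟩ := ih (by lia)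
    rcases hrd (c + l + 1 + j) (by lia) with ⟨k', hk', he⟩ | h
    swap
    · exact (hch.up_not_fresh hL hcomp hrd (m - j - 1) j (by lia)
        fun i hi => h i (by lia)).elim
    have hs := hcomp k' (by lia) _ (by lia) he
    rw [hch.edge_up j (by lia)] at he
    have huj := hch.up j (by lia)
    have hdj := hch.down (l - j) j (by lia)
    rw [hx j le_rfl, ← hdj] at huj
    rw [Sym2.eq_iff, huj] at hs
    rcases Nat.lt_or_ge k' c with hc | hc
    · have h1 := hfr (l - j) (by lia) k' (by lia)
      have h2 := hfr (l - j) (by lia) (k' + 1) (by lia)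
      tauto
    rcases Nat.lt_or_ge k' (c + 1) with hc1 | hc1
    · obtain rfl : k' = c := by lia
      rw [hch.edge_start] at he
      simp at he
    rcases Nat.lt_or_ge k' (c + l + 1) with hc2 | hc2
    · obtain ⟨a, rfl⟩ := Nat.exists_eq_add_of_le hc1
      rw [hch.edge_down a (l - a - 1) (by lia)] at he
      simp only [Sum.inl.injEq, Prod.mk.injEq, hx j le_rfl] at he
      have := hch.down_injective hL hcomp hrd hnew (by lia) hjl he.2.1
      rw [this] at he
      refine ⟨by lia, fun i hi => ?_, fun i hi => ?_⟩
      · rcases Nat.lt_succ_iff_lt_or_eq.1 hi with h | rfl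
        · exact hI i h
        · exact he.1.symm
      · rcases Nat.le_succ_iff.1 hi with h | rfl
        · exact hx i h
        · exact he.2.2.symm
    · exfalso
      obtain ⟨i, rfl⟩ := Nat.exists_eq_add_of_le hc2
      rw [hch.edge_up i (by lia)] at he
      simp only [Sum.inl.injEq, Prod.mk.injEq, hx j le_rfl, hx i (by lia)] at he
      have := hch.down_injective hL hcomp hrd hnew (by lia) hjl he.2.1
      lia

/-- If each step reuses an edge or discovers a vertex, a chain retraces its own steps. -/
theorem ladder (hch : IsChainAt u ε c l m I J x y) (hL : c + l + m + 2 ≤ L)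
    (hcomp : EdgeCompatible u ε L) (hrd : ∀ k < L, ReusesOrDiscovers u ε k)
    (hnew : ∀ k < c, ε k ≠ Sum.inr (x l)) :
    m = l ∧ (∀ i < l, J i = I i) ∧ ∀ i ≤ l, y i = x i := by
  have hfr := hch.down_fresh hL hcomp hrd hnew
  obtain ⟨hml, hI, hx⟩ := hch.up_eq_down hL hcomp hrd hnew m le_rfl
  suffices m = l by subst this; exact ⟨rfl, hI, hx⟩
  rcases hrd (c + l + m + 1) (by lia) with ⟨k', hk', he⟩ | h
  swap
  · exact (h c (by lia) (by rw [hch.start, show c + l + m + 1 + 1 = c + l + m + 2 from rfl,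
      hch.finish])).elim
  have hs := hcomp k' (by lia) _ (by lia) he
  rw [hch.edge_finish] at he
  have hum := hch.up m le_rfl
  rw [hx m le_rfl, ← hch.down (l - m) m (by lia)] at hum
  rw [Sym2.eq_iff, show c + l + m + 1 = c + l + 1 + m by lia, hum] at hs
  rcases Nat.lt_or_ge k' c with hc | hc
  · have h1 := hfr (l - m) (by lia) k' (by lia)
    have h2 := hfr (l - m) (by lia) (k' + 1) (by lia)
    tauto
  rcases Nat.lt_or_ge k' (c + 1) with hc1 | hc1
  · obtain rfl : k' = c := by lia
    rw [hch.edge_start] at he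
    simp only [Sum.inr.injEq, hx m le_rfl] at he
    exact (hch.down_injective hL hcomp hrd hnew le_rfl hml he).symm
  rcases Nat.lt_or_ge k' (c + l + 1) with hc2 | hc2
  · obtain ⟨a, rfl⟩ := Nat.exists_eq_add_of_le hc1
    rw [hch.edge_down a (l - a - 1) (by lia)] at he
    simp at he
  · obtain ⟨i, rfl⟩ := Nat.exists_eq_add_of_le hc2
    rw [hch.edge_up i (by lia)] at he
    simp at he

end IsChainAt

end Ladder

section Monomial

variable {d N : ℕ} {p : ℝ} {ε : ℕ → (Fin d × Fin N × Fin N) ⊕ Fin N} {L : ℕ}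

/-- The unscaled coordinate of the sparse random model attached to an edge: a masked Gaussian
matrix entry, or an entry of the initial vector. -/
def sparseCoord (ω : SparseOmega d N) : (Fin d × Fin N × Fin N) ⊕ Fin N → ℝ :=
  Sum.elim (fun t => ω.1 t.1 t.2.1 t.2.2 * ω.2.1 t.1 t.2.1 t.2.2) ω.2.2

/-- The expectation of the monomial in the coordinates of the sparse model that is spelled by the
first `L` edges of `ε`. -/
def monomialMoment (p : ℝ) (ε : ℕ → (Fin d × Fin N × Fin N) ⊕ Fin N) (L : ℕ) : ℝ :=
  (∏ t, gaussianMoment (edgeCount ε L (Sum.inl t)) *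
    bernoulliMoment p (edgeCount ε L (Sum.inl t))) *
    ∏ v, gaussianMoment (edgeCount ε L (Sum.inr v))

lemma prod_sparseCoord (ω : SparseOmega d N) (ε : ℕ → (Fin d × Fin N × Fin N) ⊕ Fin N) (L : ℕ) :
    ∏ k ∈ Finset.range L, sparseCoord ω (ε k) =
      (∏ i, ∏ a, ∏ b, ω.1 i a b ^ edgeCount ε L (Sum.inl (i, a, b))) *
      ((∏ i, ∏ a, ∏ b, ω.2.1 i a b ^ edgeCount ε L (Sum.inl (i, a, b))) *
        ∏ v, ω.2.2 v ^ edgeCount ε L (Sum.inr v)) := by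
  have h : ∏ k ∈ Finset.range L, sparseCoord ω (ε k) =
      ∏ e, sparseCoord ω e ^ edgeCount ε L e := by
    rw [← Finset.prod_fiberwise (Finset.range L) ε]
    refine Finset.prod_congr rfl fun e _ => ?_
    rw [edgeCount, ← Finset.prod_const]
    refine Finset.prod_congr rfl fun k hk => ?_
    rw [(Finset.mem_filter.1 hk).2]
  rw [h, Fintype.prod_sum_type, Fintype.prod_prod_type, ← mul_assoc]
  simp only [Fintype.prod_prod_type, sparseCoord, Sum.elim_inl, Sum.elim_inr, mul_pow,
    Finset.prod_mul_distrib]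

lemma integrable_prod_pi {μ : Measure ℝ} [IsProbabilityMeasure μ]
    (hμ : ∀ k : ℕ, Integrable (fun x : ℝ => x ^ k) μ) (f : Fin d → Fin N → Fin N → ℕ) :
    Integrable (fun w : Fin d → Fin N → Fin N → ℝ => ∏ i, ∏ a, ∏ b, w i a b ^ f i a b)
      (Measure.pi fun _ => Measure.pi fun _ => Measure.pi fun _ => μ) :=
  Integrable.fintype_prod (f := fun i (w : Fin N → Fin N → ℝ) => ∏ a, ∏ b, w a b ^ f i a b)
    fun i => Integrable.fintype_prod (f := fun a (w : Fin N → ℝ) => ∏ b, w b ^ f i a b)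
    fun a => Integrable.fintype_prod (f := fun b (w : ℝ) => w ^ f i a b) fun _ => hμ _

lemma integral_prod_pi {μ : Measure ℝ} [IsProbabilityMeasure μ]
    (f : Fin d → Fin N → Fin N → ℕ) :
    ∫ w : Fin d → Fin N → Fin N → ℝ, ∏ i, ∏ a, ∏ b, w i a b ^ f i a b
      ∂(Measure.pi fun _ => Measure.pi fun _ => Measure.pi fun _ => μ) =
    ∏ i, ∏ a, ∏ b, ∫ x, x ^ f i a b ∂μ := by
  rw [integral_fintype_prod_eq_prod
    (fun i (w : Fin N → Fin N → ℝ) => ∏ a, ∏ b, w a b ^ f i a b)]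
  refine Finset.prod_congr rfl fun i _ => ?_
  rw [integral_fintype_prod_eq_prod (fun a (w : Fin N → ℝ) => ∏ b, w b ^ f i a b)]
  refine Finset.prod_congr rfl fun a _ => ?_
  rw [integral_fintype_prod_eq_prod (fun b (w : ℝ) => w ^ f i a b)]

lemma integrable_monomial (hp : 0 ≤ p) (hp' : p ≤ 1)
    (ε : ℕ → (Fin d × Fin N × Fin N) ⊕ Fin N) (L : ℕ) :
    Integrable (fun ω => ∏ k ∈ Finset.range L, sparseCoord ω (ε k)) (sparseMeasure d N p) := by
  have := isProbabilityMeasure_bernoulliReal hp hp'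
  simp only [prod_sparseCoord]
  exact (integrable_prod_pi integrable_pow_gaussianReal _).mul_prod
    ((integrable_prod_pi (integrable_pow_bernoulliReal p) _).mul_prod
      (Integrable.fintype_prod (f := fun v (w : ℝ) => w ^ edgeCount ε L (Sum.inr v))
        fun v => integrable_pow_gaussianReal _))

lemma integral_monomial (hp : 0 ≤ p) (hp' : p ≤ 1)
    (ε : ℕ → (Fin d × Fin N × Fin N) ⊕ Fin N) (L : ℕ) :
    ∫ ω, ∏ k ∈ Finset.range L, sparseCoord ω (ε k) ∂sparseMeasure d N p =
      monomialMoment p ε L := by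
  have := isProbabilityMeasure_bernoulliReal hp hp'
  simp only [prod_sparseCoord]
  rw [sparseMeasure, integral_prod_mul
      (fun w : Fin d → Fin N → Fin N → ℝ =>
        ∏ i, ∏ a, ∏ b, w i a b ^ edgeCount ε L (Sum.inl (i, a, b)))
      (fun w : (Fin d → Fin N → Fin N → ℝ) × (Fin N → ℝ) =>
        (∏ i, ∏ a, ∏ b, w.1 i a b ^ edgeCount ε L (Sum.inl (i, a, b))) *
          ∏ v, w.2 v ^ edgeCount ε L (Sum.inr v)),
    integral_prod_mul
      (fun w : Fin d → Fin N → Fin N → ℝ =>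
        ∏ i, ∏ a, ∏ b, w i a b ^ edgeCount ε L (Sum.inl (i, a, b)))
      (fun w : Fin N → ℝ => ∏ v, w v ^ edgeCount ε L (Sum.inr v)),
    integral_prod_pi, integral_prod_pi,
    integral_fintype_prod_eq_prod (fun v (w : ℝ) => w ^ edgeCount ε L (Sum.inr v))]
  simp only [integral_pow_bernoulliReal hp hp', monomialMoment, Fintype.prod_prod_type,
    Finset.prod_mul_distrib, mul_assoc, gaussianMoment]

lemma bernoulliMoment_nonneg (hp : 0 ≤ p) (k : ℕ) : 0 ≤ bernoulliMoment p k := by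
  unfold bernoulliMoment; split_ifs <;> simp [hp]

lemma monomialMoment_nonneg (hp : 0 ≤ p) : 0 ≤ monomialMoment p ε L :=
  mul_nonneg
    (Finset.prod_nonneg fun _ _ =>
      mul_nonneg (gaussianMoment_nonneg _) (bernoulliMoment_nonneg hp _))
    (Finset.prod_nonneg fun _ _ => gaussianMoment_nonneg _)

lemma even_edgeCount_of_monomialMoment_ne_zero (h : monomialMoment p ε L ≠ 0)
    (e : (Fin d × Fin N × Fin N) ⊕ Fin N) : Even (edgeCount ε L e) := by
  by_contra ho
  have hz := gaussianMoment_odd (Nat.not_even_iff_odd.1 ho)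
  refine h ?_
  rcases e with t | v
  · exact mul_eq_zero_of_left (Finset.prod_eq_zero (Finset.mem_univ t) (by rw [hz, zero_mul])) _
  · exact mul_eq_zero_of_right _ (Finset.prod_eq_zero (Finset.mem_univ v) hz)

/-- The number of distinct matrix entries among the first `L` edges. -/
def numMatrixEdges (ε : ℕ → (Fin d × Fin N × Fin N) ⊕ Fin N) (L : ℕ) : ℕ :=
  (Finset.univ.filter fun t => 0 < edgeCount ε L (Sum.inl t)).card

/-- The number of distinct entries of the initial vector among the first `L` edges. -/
def numVectorEdges (ε : ℕ → (Fin d × Fin N × Fin N) ⊕ Fin N) (L : ℕ) : ℕ :=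
  (Finset.univ.filter fun v => 0 < edgeCount ε L (Sum.inr v)).card

lemma numMatrixEdges_add_numVectorEdges :
    numMatrixEdges ε L + numVectorEdges ε L = ((Finset.range L).image ε).card := by
  have h : (Finset.range L).image ε = Finset.univ.filter fun e => 0 < edgeCount ε L e := by
    ext e; simp only [Finset.mem_filter, Finset.mem_univ, true_and, edgeCount_pos_iff]
  rw [h, numMatrixEdges, numVectorEdges]
  simp only [Finset.card_filter, Fintype.sum_sum_type]

lemma two_mul_numVectorEdges_le (h : ∀ e, Even (edgeCount ε L e)) :
    2 * numVectorEdges ε L ≤ ((Finset.range L).filter fun k => (ε k).isRight).card := by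
  have h1 : ∑ v, edgeCount ε L (Sum.inr v) =
      ((Finset.range L).filter fun k => (ε k).isRight).card := by
    have h3 := Finset.card_eq_sum_card_fiberwise (f := ε)
      (s := (Finset.range L).filter fun k => (ε k).isRight) (t := Finset.univ) (by simp)
    rw [h3, Fintype.sum_sum_type]
    simp only [Finset.filter_filter, edgeCount]
    rw [Finset.sum_eq_zero (s := Finset.univ (α := Fin d × Fin N × Fin N)), zero_add]
    · refine Finset.sum_congr rfl fun v _ => ?_
      congr 1
      refine Finset.filter_congr fun k _ => ?_
      constructor
      · intro h; simp [h]
      · exact fun h => h.2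
    · intro t _
      rw [Finset.card_eq_zero, Finset.filter_eq_empty_iff]
      rintro k _ ⟨h1, h2⟩
      simp [h2] at h1
  rw [← h1, numVectorEdges, Finset.card_filter, Finset.mul_sum]
  refine Finset.sum_le_sum fun v _ => ?_
  obtain ⟨r, hr⟩ := h (Sum.inr v)
  split_ifs <;> lia

lemma prod_bernoulliMoment :
    ∏ t, bernoulliMoment p (edgeCount ε L (Sum.inl t)) = p ^ numMatrixEdges ε L := by
  rw [numMatrixEdges, ← Finset.prod_const, Finset.prod_filter]
  refine Finset.prod_congr rfl fun t _ => ?_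
  simp only [bernoulliMoment, Nat.pos_iff_ne_zero, ite_not]

lemma monomialMoment_eq : monomialMoment p ε L =
    p ^ numMatrixEdges ε L * ∏ e, gaussianMoment (edgeCount ε L e) := by
  rw [monomialMoment, Finset.prod_mul_distrib, prod_bernoulliMoment, Fintype.prod_sum_type]
  ring

lemma monomialMoment_le (hp : 0 ≤ p) :
    monomialMoment p ε L ≤ p ^ numMatrixEdges ε L * L.factorial := by
  rw [monomialMoment_eq]
  refine mul_le_mul_of_nonneg_left ?_ (by positivity)
  have hs : ∑ e, edgeCount ε L e = L := by
    have h3 := Finset.card_eq_sum_card_fiberwise (f := ε)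
      (s := Finset.range L) (t := Finset.univ) (by simp)
    rw [Finset.card_range] at h3
    exact h3.symm
  have h2 := Nat.le_of_dvd (Nat.factorial_pos _)
    (Nat.prod_factorial_dvd_factorial_sum Finset.univ (edgeCount ε L))
  rw [hs] at h2
  calc ∏ e, gaussianMoment (edgeCount ε L e) ≤ ∏ e, ((edgeCount ε L e).factorial : ℝ) :=
        Finset.prod_le_prod (fun _ _ => gaussianMoment_nonneg _)
          fun _ _ => gaussianMoment_le_factorial _
    _ ≤ L.factorial := by exact_mod_cast h2

lemma le_monomialMoment (hp : 0 ≤ p) (h : ∀ e, Even (edgeCount ε L e)) :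
    p ^ numMatrixEdges ε L ≤ monomialMoment p ε L := by
  rw [monomialMoment_eq]
  exact le_mul_of_one_le_right (by positivity)
    (Finset.one_le_prod fun e _ => one_le_gaussianMoment (h e))

lemma monomialMoment_eq_pow (h : ∀ e, 0 < edgeCount ε L e → edgeCount ε L e = 2) :
    monomialMoment p ε L = p ^ numMatrixEdges ε L := by
  rw [monomialMoment_eq, Finset.prod_eq_one, mul_one]
  intro e _
  rcases Nat.eq_zero_or_pos (edgeCount ε L e) with h0 | h0
  · rw [h0, gaussianMoment_zero]
  · rw [h e h0, gaussianMoment_two]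

end Monomial

section Concat

variable {α : Type*} {f g : ℕ → α} {n m : ℕ}

/-- The sequence that follows `f` for `n` steps and then `g`. -/
def concatAt (n : ℕ) (f g : ℕ → α) (k : ℕ) : α := if k < n then f k else g (k - n)

lemma concatAt_of_lt {k : ℕ} (h : k < n) : concatAt n f g k = f k := if_pos h

lemma concatAt_add (k : ℕ) : concatAt n f g (n + k) = g k := by simp [concatAt]

lemma prod_range_concatAt {M : Type*} [CommMonoid M] (F : α → M) :
    ∏ k ∈ Finset.range (n + m), F (concatAt n f g k) =
      (∏ k ∈ Finset.range n, F (f k)) * ∏ k ∈ Finset.range m, F (g k) := by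
  rw [Finset.prod_range_add]
  congr 1
  · exact Finset.prod_congr rfl fun k hk => by rw [concatAt_of_lt (Finset.mem_range.1 hk)]
  · exact Finset.prod_congr rfl fun k _ => by rw [concatAt_add]

lemma edgeCount_concatAt [DecidableEq α] (e : α) :
    edgeCount (concatAt n f g) (n + m) e = edgeCount f n e + edgeCount g m e := by
  simp only [edgeCount, Finset.card_filter]
  rw [Finset.sum_range_add]
  congr 1
  · exact Finset.sum_congr rfl fun k hk => by rw [concatAt_of_lt (Finset.mem_range.1 hk)]
  · exact Finset.sum_congr rfl fun k _ => by rw [concatAt_add]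

end Concat

section Chain

variable {D V : Type*} {l m : ℕ} {I J : ℕ → D} {x y x' y' : ℕ → V}

/-- The edges of the path `x 0, …, x l` spelling the first `l` letters of `I`, followed by the
edge from `x l` to the root. -/
def pathEdge (l : ℕ) (I : ℕ → D) (x : ℕ → V) (k : ℕ) : (D × V × V) ⊕ V :=
  if k < l then Sum.inl (I k, x k, x (k + 1)) else Sum.inr (x l)

/-- The edges of the closed walk from the root along `x l, …, x 0 = y 0, …, y m` and back. -/
def chainEdge (l m : ℕ) (I J : ℕ → D) (x y : ℕ → V) : ℕ → (D × V × V) ⊕ V :=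
  concatAt (l + 1) (fun k => pathEdge l I x (l - k)) (pathEdge m J y)

/-- The vertices of the closed walk from the root along `x l, …, x 0 = y 0, …, y m` and back. -/
def chainVertex (l m : ℕ) (x y : ℕ → V) (k : ℕ) : Option V :=
  if k = 0 then none
  else if k ≤ l + 1 then some (x (l + 1 - k))
  else if k ≤ l + m + 1 then some (y (k - (l + 1)))
  else none

/-- The two endpoints of an edge, the root being `none`. -/
def edgeEnds : (D × V × V) ⊕ V → Sym2 (Option V) :=
  Sum.elim (fun t => s(some t.2.1, some t.2.2)) (fun v => s(none, some v))

lemma prod_range_chainEdge {M : Type*} [CommMonoid M] (F : (D × V × V) ⊕ V → M) :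
    ∏ k ∈ Finset.range (l + m + 2), F (chainEdge l m I J x y k) =
      (∏ k ∈ Finset.range (l + 1), F (pathEdge l I x k)) *
        ∏ k ∈ Finset.range (m + 1), F (pathEdge m J y k) := by
  rw [chainEdge, show l + m + 2 = (l + 1) + (m + 1) by lia, prod_range_concatAt,
    ← Finset.prod_range_reflect (fun k => F (pathEdge l I x k))]
  simp

lemma edgeEnds_chainEdge (hxy : x 0 = y 0) {k : ℕ} (hk : k < l + m + 2) :
    edgeEnds (chainEdge l m I J x y k) = s(chainVertex l m x y k, chainVertex l m x y (k + 1)) := by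
  rcases Nat.eq_zero_or_pos k with rfl | h0
  · simp [chainEdge, concatAt, pathEdge, chainVertex, edgeEnds]
  rcases Nat.lt_or_ge k (l + 1) with h1 | h1
  · obtain ⟨a, rfl⟩ := Nat.exists_eq_add_of_le (Nat.lt_succ_iff.1 h1)
    have e1 : k + a - k = a := by lia
    have e2 : k + a + 1 - k = a + 1 := by lia
    have e3 : k + a + 1 - (k + 1) = a := by lia
    simp only [chainEdge, concatAt, pathEdge, chainVertex, edgeEnds, h1, e1, e2, e3, if_true,
      show a < k + a by lia, show k ≠ 0 by lia, if_false, show k ≤ k + a + 1 by lia,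
      show k + 1 ≤ k + a + 1 by lia, show k + 1 ≠ 0 by lia, Sum.elim_inl]
    exact Sym2.eq_swap
  obtain ⟨j, rfl⟩ := Nat.exists_eq_add_of_le h1
  have hv : chainVertex l m x y (l + 1 + j) = some (y j) := by
    rcases Nat.eq_zero_or_pos j with rfl | hj
    · simp [chainVertex, hxy]
    · have e1 : l + 1 + j - (l + 1) = j := by lia
      simp only [chainVertex, e1, show l + 1 + j ≠ 0 by lia, if_false,
        show ¬ l + 1 + j ≤ l + 1 by lia, show l + 1 + j ≤ l + m + 1 by lia, if_true]
  rw [chainEdge, concatAt_add, hv, pathEdge]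
  have e1 : l + 1 + j + 1 - (l + 1) = j + 1 := by lia
  by_cases hj : j < m
  · simp only [hj, chainVertex, edgeEnds, e1, show l + 1 + j + 1 ≠ 0 by lia, if_false,
        show ¬ l + 1 + j + 1 ≤ l + 1 by lia, show l + 1 + j + 1 ≤ l + m + 1 by lia, if_true,
        Sum.elim_inl]
  · obtain rfl : j = m := by lia
    simp only [lt_irrefl, chainVertex, edgeEnds, show l + 1 + j + 1 ≠ 0 by lia, if_false,
        show ¬ l + 1 + j + 1 ≤ l + 1 by lia, show ¬ l + 1 + j + 1 ≤ l + j + 1 by lia,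
        Sum.elim_inr]
    exact Sym2.eq_swap

lemma isChainAt_of_eq (hxy : x 0 = y 0) {u : ℕ → Option V} {ε : ℕ → (D × V × V) ⊕ V} {c : ℕ}
    (hu : ∀ k ≤ l + m + 2, u (c + k) = chainVertex l m x y k)
    (hε : ∀ k < l + m + 2, ε (c + k) = chainEdge l m I J x y k) :
    IsChainAt u ε c l m I J x y where
  start := by simpa [chainVertex] using hu 0 (by lia)
  down a b hab := by
    rw [add_assoc, hu _ (by lia), chainVertex, if_neg (by lia), if_pos (by lia),
      show l + 1 - (1 + a) = b by lia]
  up j hj := by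
    rw [show c + l + 1 + j = c + (l + 1 + j) by lia, hu _ (by lia), chainVertex, if_neg (by lia)]
    rcases Nat.eq_zero_or_pos j with rfl | hj0
    · simp [hxy]
    · rw [if_neg (by lia), if_pos (by lia), show l + 1 + j - (l + 1) = j by lia]
  finish := by
    rw [show c + l + m + 2 = c + (l + m + 2) by lia, hu _ le_rfl, chainVertex, if_neg (by lia),
      if_neg (by lia), if_neg (by lia)]
  edge_start := by simpa [chainEdge, concatAt, pathEdge] using hε 0 (by lia)
  edge_down a b hab := by
    rw [add_assoc, hε _ (by lia), chainEdge, concatAt_of_lt (by lia), pathEdge,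
      show l - (1 + a) = b by lia, if_pos (by lia)]
  edge_up j hj := by
    rw [show c + l + 1 + j = c + (l + 1 + j) by lia, hε _ (by lia), chainEdge, concatAt_add,
      pathEdge, if_pos hj]
  edge_finish := by
    rw [show c + l + m + 1 = c + (l + 1 + m) by lia, hε _ (by lia), chainEdge, concatAt_add,
      pathEdge, if_neg (by lia)]

lemma IsChainAt.isRight_iff {u : ℕ → Option V} {ε : ℕ → (D × V × V) ⊕ V} {c k : ℕ}
    (h : IsChainAt u ε c l m I J x y) (hk : k < l + m + 2) (hr : (ε (c + k)).isRight) :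
    k = 0 ∨ k = l + m + 1 := by
  by_contra! hne
  rcases Nat.lt_or_ge k (l + 1) with h1 | h1
  · have := h.edge_down (k - 1) (l - k) (by lia)
    rw [show c + 1 + (k - 1) = c + k by lia] at this
    simp [this] at hr
  · have := h.edge_up (k - (l + 1)) (by lia)
    rw [show c + l + 1 + (k - (l + 1)) = c + k by lia] at this
    simp [this] at hr

/-- The edges of two closed walks, traversed one after the other. -/
def doubleEdge (l m : ℕ) (I J : ℕ → D) (x y z w : ℕ → V) : ℕ → (D × V × V) ⊕ V :=
  concatAt (l + m + 2) (chainEdge l m I J x y) (chainEdge l m I J z w)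

/-- The vertices of two closed walks, traversed one after the other. -/
def doubleVertex (l m : ℕ) (x y z w : ℕ → V) : ℕ → Option V :=
  concatAt (l + m + 2) (chainVertex l m x y) (chainVertex l m z w)

lemma isChainAt_double_left (hxy : x 0 = y 0) :
    IsChainAt (doubleVertex l m x y x' y') (doubleEdge l m I J x y x' y') 0 l m I J x y := by
  refine isChainAt_of_eq hxy (fun k hk => ?_) fun k hk => ?_
  · rw [zero_add]
    rcases hk.lt_or_eq with h | rfl
    · exact concatAt_of_lt h
    · exact (concatAt_add (n := l + m + 2) 0).trans (by simp [chainVertex])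
  · rw [zero_add]
    exact concatAt_of_lt hk

lemma isChainAt_double_right (hxy' : x' 0 = y' 0) :
    IsChainAt (doubleVertex l m x y x' y') (doubleEdge l m I J x y x' y') (l + m + 2) l m
      I J x' y' :=
  isChainAt_of_eq hxy' (fun k _ => concatAt_add k) fun k _ => concatAt_add k

lemma edgeCompatible_double (hxy : x 0 = y 0) (hxy' : x' 0 = y' 0) :
    EdgeCompatible (doubleVertex l m x y x' y') (doubleEdge l m I J x y x' y')
      (l + m + 2 + (l + m + 2)) := by
  have key : ∀ k < l + m + 2 + (l + m + 2), edgeEnds (doubleEdge l m I J x y x' y' k) =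
      s(doubleVertex l m x y x' y' k, doubleVertex l m x y x' y' (k + 1)) := by
    intro k hk
    rcases Nat.lt_or_ge k (l + m + 2) with h | h
    · rw [doubleEdge, concatAt_of_lt h, edgeEnds_chainEdge hxy h, doubleVertex, concatAt_of_lt h]
      rcases Nat.lt_or_ge (k + 1) (l + m + 2) with h' | h'
      · rw [concatAt_of_lt h']
      · obtain rfl : k = l + m + 1 := by lia
        rw [show concatAt (l + m + 2) (chainVertex l m x y) (chainVertex l m x' y') (l + m + 1 + 1)
          = chainVertex l m x' y' 0 from concatAt_add 0]
        simp [chainVertex]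
    · obtain ⟨j, rfl⟩ := Nat.exists_eq_add_of_le h
      rw [doubleEdge, concatAt_add, doubleVertex, concatAt_add,
        show l + m + 2 + j + 1 = l + m + 2 + (j + 1) from rfl, concatAt_add,
        edgeEnds_chainEdge hxy' (by lia)]
  intro k hk k' hk' he
  rw [← key k hk, ← key k' hk', he]

lemma card_isRight_doubleEdge_le (hxy : x 0 = y 0) (hxy' : x' 0 = y' 0) :
    ((Finset.range (l + m + 2 + (l + m + 2))).filter
      fun k => (doubleEdge l m I J x y x' y' k).isRight).card ≤ 4 := by
  have h1 := isChainAt_double_left (I := I) (J := J) (l := l) (m := m) (x' := x') (y' := y') hxy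
  have h2 := isChainAt_double_right (I := I) (J := J) (l := l) (m := m) (x := x) (y := y) hxy'
  refine (Finset.card_le_card (t := {0, l + m + 1, l + m + 2, l + m + 2 + (l + m + 1)})
    fun k hk => ?_).trans Finset.card_le_four
  simp only [Finset.mem_filter, Finset.mem_range] at hk
  simp only [Finset.mem_insert, Finset.mem_singleton]
  rcases Nat.lt_or_ge k (l + m + 2) with h | h
  · have := h1.isRight_iff h (by simpa using hk.2)
    lia
  · obtain ⟨j, rfl⟩ := Nat.exists_eq_add_of_le h
    have := h2.isRight_iff (by lia) hk.2
    lia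

/-- The vertices visited by two closed walks. -/
def doubleSupport [DecidableEq V] (l m : ℕ) (x y x' y' : ℕ → V) : Finset V :=
  ((Finset.range (l + 1)).image x ∪ (Finset.range (m + 1)).image y) ∪
    ((Finset.range (l + 1)).image x' ∪ (Finset.range (m + 1)).image y')

variable [DecidableEq D] [DecidableEq V]

lemma card_doubleSupport_le_card_image (hxy : x 0 = y 0) (hxy' : x' 0 = y' 0) :
    (doubleSupport l m x y x' y').card + 1 ≤
      ((Finset.range (l + m + 2 + (l + m + 2) + 1)).image (doubleVertex l m x y x' y')).card := by
  have h1 := isChainAt_double_left (I := fun _ => ()) (J := fun _ => ()) (l := l) (m := m)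
    (x' := x') (y' := y') hxy
  have h2 := isChainAt_double_right (I := fun _ => ()) (J := fun _ => ()) (l := l) (m := m)
    (x := x) (y := y) hxy'
  have hmem : ∀ (k : ℕ) (w : Option V), k < l + m + 2 + (l + m + 2) + 1 →
      doubleVertex l m x y x' y' k = w →
      w ∈ (Finset.range (l + m + 2 + (l + m + 2) + 1)).image (doubleVertex l m x y x' y') :=
    fun k w hk hw => Finset.mem_image.2 ⟨k, Finset.mem_range.2 hk, hw⟩
  rw [← Finset.card_map Function.Embedding.some, ← Finset.card_insert_of_notMem (a := none)
    (by simp)]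
  refine Finset.card_le_card fun w hw => ?_
  rw [Finset.mem_insert, Finset.mem_map] at hw
  rcases hw with rfl | ⟨v, hv, rfl⟩
  · exact hmem 0 _ (by lia) h1.start
  simp only [doubleSupport, Finset.mem_union, Finset.mem_image, Finset.mem_range] at hv
  rcases hv with (⟨b, hb, rfl⟩ | ⟨b, hb, rfl⟩) | (⟨b, hb, rfl⟩ | ⟨b, hb, rfl⟩)
  · exact hmem _ _ (by lia) (h1.down (l - b) b (by lia))
  · exact hmem _ _ (by lia) (h1.up b (by lia))
  · exact hmem _ _ (by lia) (h2.down (l - b) b (by lia))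
  · exact hmem _ _ (by lia) (h2.up b (by lia))

lemma card_doubleSupport_le (hxy : x 0 = y 0) (hxy' : x' 0 = y' 0) :
    (doubleSupport l m x y x' y').card ≤
      ((Finset.range (l + m + 2 + (l + m + 2))).image (doubleEdge l m I J x y x' y')).card := by
  have h1 := card_doubleSupport_le_card_image (l := l) (m := m) hxy hxy'
  have h2 := card_image_le (edgeCompatible_double (l := l) (m := m) (I := I) (J := J) hxy hxy')
  lia

/-- Two closed walks using each edge evenly often and visiting as many vertices as possible retrace
their own steps. -/
theorem double_ladder (hxy : x 0 = y 0) (hxy' : x' 0 = y' 0)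
    (heven : ∀ e, Even (edgeCount (doubleEdge l m I J x y x' y') (l + m + 2 + (l + m + 2)) e))
    (hcard : l + m + 2 ≤ (doubleSupport l m x y x' y').card) :
    (∀ e, 0 < edgeCount (doubleEdge l m I J x y x' y') (l + m + 2 + (l + m + 2)) e →
      edgeCount (doubleEdge l m I J x y x' y') (l + m + 2 + (l + m + 2)) e = 2) ∧
    m = l ∧ (∀ i < l, J i = I i) ∧ (∀ i ≤ l, y i = x i) ∧ ∀ i ≤ l, y' i = x' i := by
  have hcomp := edgeCompatible_double (l := l) (m := m) (I := I) (J := J) hxy hxy'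
  have hs := card_doubleSupport_le_card_image (l := l) (m := m) hxy hxy'
  have h1 := isChainAt_double_left (I := I) (J := J) (l := l) (m := m) (x' := x') (y' := y') hxy
  have h2 := isChainAt_double_right (I := I) (J := J) (l := l) (m := m) (x := x) (y := y) hxy'
  have hF := two_mul_card_image_le heven
  have hF' := card_doubleSupport_le (l := l) (m := m) (I := I) (J := J) hxy hxy'
  have htwo := fun e => edgeCount_eq_two (e := e) heven (by lia)
  have hrd : ∀ k < l + m + 2 + (l + m + 2), ReusesOrDiscovers (doubleVertex l m x y x' y')
      (doubleEdge l m I J x y x' y') k :=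
    fun k hk => reusesOrDiscovers_of_card hcomp (by lia) hk
  obtain ⟨hml, hI, hx⟩ := h1.ladder (by lia) hcomp hrd (by simp)
  refine ⟨htwo, hml, hI, hx, (h2.ladder (by lia) hcomp hrd fun k hk he => ?_).2.2⟩
  obtain ⟨h3, h4⟩ : doubleEdge l m I J x y x' y' 0 = Sum.inr (x' l) ∧
      doubleEdge l m I J x y x' y' (l + m + 1) = Sum.inr (x' l) := by
    have e1 := h1.edge_start
    have e2 := h1.edge_finish
    rw [zero_add] at e2
    rw [hml, hx l le_rfl] at e2
    subst hml
    have := h1.isRight_iff hk (by simp [he])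
    rcases this with rfl | rfl
    · rw [e1] at he; rw [e1, e2]; exact ⟨he, he⟩
    · rw [e2] at he; rw [e1, e2]; exact ⟨he, he⟩
  have h5 := h2.edge_start
  have hsub : ({0, l + m + 1, l + m + 2} : Finset ℕ) ⊆
      (Finset.range (l + m + 2 + (l + m + 2))).filter
        (doubleEdge l m I J x y x' y' · = Sum.inr (x' l)) := by
    intro k hk
    simp only [Finset.mem_insert, Finset.mem_singleton] at hk
    simp only [Finset.mem_filter, Finset.mem_range]
    rcases hk with rfl | rfl | rfl
    · exact ⟨by lia, h3⟩
    · exact ⟨by lia, h4⟩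
    · exact ⟨by lia, h5⟩
  have h6 := Finset.card_le_card hsub
  rw [Finset.card_insert_of_notMem (by simp), Finset.card_pair (by lia)] at h6
  change 3 ≤ edgeCount _ _ _ at h6
  have h7 := htwo (Sum.inr (x' l)) (by lia)
  lia

end Chain

section Expansion

variable {d N l m : ℕ} {p : ℝ}

/-- The extension of a finite path to `ℕ` that stays at its last vertex. -/
def pathExt {V : Type*} (x : Fin (l + 1) → V) (k : ℕ) : V :=
  x ⟨min k l, Nat.lt_succ_of_le (min_le_right k l)⟩

lemma pathExt_zero {V : Type*} (x : Fin (l + 1) → V) : pathExt x 0 = x 0 := by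
  simp only [pathExt, Nat.zero_min, Fin.mk_zero']

lemma pathExt_val {V : Type*} (x : Fin (l + 1) → V) (i : Fin (l + 1)) : pathExt x i = x i := by
  simp only [pathExt, min_eq_left (Nat.lt_succ_iff.1 i.2)]

lemma pathExt_cons_succ {V : Type*} (a : V) (x : Fin (l + 1) → V) (k : ℕ) :
    pathExt (Fin.cons a x : Fin (l + 1 + 1) → V) (k + 1) = pathExt x k := by
  have h : (⟨min (k + 1) (l + 1), Nat.lt_succ_of_le (min_le_right _ _)⟩ : Fin (l + 1 + 1)) =
      Fin.succ ⟨min k l, Nat.lt_succ_of_le (min_le_right k l)⟩ := by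
    ext; simp
  rw [pathExt, h, Fin.cons_succ, pathExt]

/-- The letters of a word, continued by `z`. -/
def wordExt {D : Type*} (z : D) (I : List D) (k : ℕ) : D := I.getD k z

lemma wordExt_injective {D : Type*} (z : D) {I J : List D} (hl : J.length = I.length)
    (h : ∀ i < I.length, wordExt z J i = wordExt z I i) : I = J := by
  refine List.ext_getElem hl.symm fun i h1 h2 => ?_
  have := h i h1
  simpa [wordExt, h1, h2] using this.symm

lemma sparseA_apply (ω : SparseOmega d N) (i : Fin d) (a b : Fin N) :
    sparseA p ω i a b = (Real.sqrt (N * p))⁻¹ * sparseCoord ω (Sum.inl (i, a, b)) := by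
  simp [sparseA, sparseCoord]

lemma sparseFeature_eq_sum (z : Fin d) (I : List (Fin d)) (ω : SparseOmega d N) (a : Fin N) :
    sparseFeature p I ω a = (Real.sqrt (N * p))⁻¹ ^ I.length *
      ∑ x : Fin (I.length + 1) → Fin N, if x 0 = a then
        ∏ k ∈ Finset.range (I.length + 1),
          sparseCoord ω (pathEdge I.length (wordExt z I) (pathExt x) k) else 0 := by
  induction I generalizing a with
  | nil =>
    rw [List.length_nil, ← (Equiv.funUnique (Fin 1) (Fin N)).symm.sum_comp]
    simp [sparseFeature, wordProd, pathEdge, sparseCoord, pathExt]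
  | cons i I ih =>
    have h1 : sparseFeature p (i :: I) ω a =
        ∑ b, sparseA p ω i a b * sparseFeature p I ω b := by
      simp only [sparseFeature, wordProd, List.map_cons, List.prod_cons, ← Matrix.mulVec_mulVec]
      rfl
    have h2 : ∀ b (x : Fin (I.length + 1) → Fin N),
        ∏ k ∈ Finset.range (I.length + 1 + 1), sparseCoord ω (pathEdge (I.length + 1)
          (wordExt z (i :: I)) (pathExt (Fin.cons b x : Fin (I.length + 1 + 1) → Fin N)) k) =
        (∏ k ∈ Finset.range (I.length + 1),
          sparseCoord ω (pathEdge I.length (wordExt z I) (pathExt x) k)) *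
          sparseCoord ω (Sum.inl (i, b, x 0)) := by
      intro b x
      rw [Finset.prod_range_succ']
      congr 1
      refine Finset.prod_congr rfl fun k _ => ?_
      simp only [pathEdge, pathExt_cons_succ, Nat.add_lt_add_iff_right, wordExt,
        List.getD_cons_succ]
    rw [h1]
    simp only [ih, sparseA_apply, List.length_cons]
    rw [← (Fin.consEquiv fun _ : Fin (I.length + 1 + 1) => Fin N).sum_comp, Fintype.sum_prod_type]
    simp only [Fin.consEquiv, Equiv.coe_fn_mk, h2, Fin.cons_zero]
    simp only [Finset.mul_sum, mul_ite, mul_zero]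
    refine Finset.sum_comm.trans (Eq.trans ?_ Finset.sum_comm)
    refine Finset.sum_congr rfl fun x _ => ?_
    simp only [Finset.sum_ite_eq, Finset.sum_ite_eq', Finset.mem_univ, if_true]
    ring

/-- The pairs of paths with the same starting point. -/
def rootedPairs (l m N : ℕ) : Finset ((Fin (l + 1) → Fin N) × (Fin (m + 1) → Fin N)) :=
  Finset.univ.filter fun q => q.1 0 = q.2 0

lemma eq_of_mem_rootedPairs {q : (Fin (l + 1) → Fin N) × (Fin (m + 1) → Fin N)}
    (hq : q ∈ rootedPairs l m N) : pathExt q.1 0 = pathExt q.2 0 := by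
  rw [pathExt_zero, pathExt_zero]
  exact (Finset.mem_filter.1 hq).2

/-- The unscaled inner product of two features, expanded over pairs of paths. -/
def pairSum (l m : ℕ) (I J : ℕ → Fin d) (ω : SparseOmega d N) : ℝ :=
  ∑ q ∈ rootedPairs l m N, ∏ k ∈ Finset.range (l + m + 2),
    sparseCoord ω (chainEdge l m I J (pathExt q.1) (pathExt q.2) k)

lemma dotProduct_sparseFeature (z : Fin d) (I J : List (Fin d)) (ω : SparseOmega d N) :
    sparseFeature p I ω ⬝ᵥ sparseFeature p J ω =
      (Real.sqrt (N * p))⁻¹ ^ (I.length + J.length) *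
        pairSum I.length J.length (wordExt z I) (wordExt z J) ω := by
  simp only [dotProduct, pairSum, rootedPairs, Finset.sum_filter, Fintype.sum_prod_type,
    sparseFeature_eq_sum z, prod_range_chainEdge, pow_add]
  simp only [mul_mul_mul_comm, ← Finset.mul_sum, Finset.sum_mul_sum]
  congr 1
  rw [Finset.sum_comm]
  refine Finset.sum_congr rfl fun x _ => ?_
  simp only [ite_mul, zero_mul]
  rw [Finset.sum_ite_eq, if_pos (Finset.mem_univ _), Finset.mul_sum]
  simp only [mul_ite, mul_zero, eq_comm]

lemma sq_pairSum (I J : ℕ → Fin d) (ω : SparseOmega d N) :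
    pairSum l m I J ω ^ 2 = ∑ q ∈ rootedPairs l m N, ∑ r ∈ rootedPairs l m N,
      ∏ k ∈ Finset.range (l + m + 2 + (l + m + 2)),
        sparseCoord ω (doubleEdge l m I J (pathExt q.1) (pathExt q.2) (pathExt r.1)
          (pathExt r.2) k) := by
  simp only [sq, pairSum, Finset.sum_mul_sum, doubleEdge, prod_range_concatAt]

lemma integrable_pairSum (hp : 0 ≤ p) (hp' : p ≤ 1) (I J : ℕ → Fin d) :
    Integrable (pairSum (N := N) l m I J) (sparseMeasure d N p) :=
  integrable_finsetSum _ fun _ _ => integrable_monomial hp hp' _ _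

lemma integral_pairSum (hp : 0 ≤ p) (hp' : p ≤ 1) (I J : ℕ → Fin d) :
    ∫ ω, pairSum (N := N) l m I J ω ∂sparseMeasure d N p =
      ∑ q ∈ rootedPairs l m N,
        monomialMoment p (chainEdge l m I J (pathExt q.1) (pathExt q.2)) (l + m + 2) := by
  simp only [pairSum]
  rw [integral_finsetSum _ fun _ _ => integrable_monomial hp hp' _ _]
  simp only [integral_monomial hp hp']

lemma integrable_sq_pairSum (hp : 0 ≤ p) (hp' : p ≤ 1) (I J : ℕ → Fin d) :
    Integrable (fun ω => pairSum (N := N) l m I J ω ^ 2) (sparseMeasure d N p) := by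
  simp only [sq_pairSum]
  exact integrable_finsetSum _ fun _ _ => integrable_finsetSum _ fun _ _ =>
    integrable_monomial hp hp' _ _

lemma integral_sq_pairSum (hp : 0 ≤ p) (hp' : p ≤ 1) (I J : ℕ → Fin d) :
    ∫ ω, pairSum (N := N) l m I J ω ^ 2 ∂sparseMeasure d N p =
      ∑ q ∈ rootedPairs l m N, ∑ r ∈ rootedPairs l m N,
        monomialMoment p (doubleEdge l m I J (pathExt q.1) (pathExt q.2) (pathExt r.1)
          (pathExt r.2)) (l + m + 2 + (l + m + 2)) := by
  simp only [sq_pairSum]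
  rw [integral_finsetSum _ fun _ _ => integrable_finsetSum _ fun _ _ =>
    integrable_monomial hp hp' _ _]
  refine Finset.sum_congr rfl fun q _ => ?_
  rw [integral_finsetSum _ fun _ _ => integrable_monomial hp hp' _ _]
  simp only [integral_monomial hp hp']

end Expansion

section Counting

variable {l m N : ℕ}

lemma exists_comp_eq_of_card {V : Type*} {S : Finset V} {v : ℕ} (hS : S.card = v) :
    ∃ g : Fin v → V, ∀ (n : ℕ) (f : Fin n → V), (∀ i, f i ∈ S) → ∃ h : Fin n → Fin v,
      (fun i => g (h i)) = f := by
  have e := S.equivFinOfCardEq hS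
  exact ⟨fun i => e.symm i, fun n f hf => ⟨fun i => e ⟨f i, hf i⟩, by simp⟩⟩

lemma card_filter_doubleSupport_le (s : Finset (((Fin (l + 1) → Fin N) × (Fin (m + 1) → Fin N)) ×
    ((Fin (l + 1) → Fin N) × (Fin (m + 1) → Fin N)))) (v : ℕ) :
    (s.filter fun Q => (doubleSupport l m (pathExt Q.1.1) (pathExt Q.1.2) (pathExt Q.2.1)
      (pathExt Q.2.2)).card = v).card ≤ N ^ v * v ^ (l + m + 2 + (l + m + 2)) := by
  let F : (Fin v → Fin N) × ((Fin (l + 1) → Fin v) × (Fin (m + 1) → Fin v)) ×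
      ((Fin (l + 1) → Fin v) × (Fin (m + 1) → Fin v)) →
      ((Fin (l + 1) → Fin N) × (Fin (m + 1) → Fin N)) ×
        ((Fin (l + 1) → Fin N) × (Fin (m + 1) → Fin N)) := fun t =>
    ((fun i => t.1 (t.2.1.1 i), fun i => t.1 (t.2.1.2 i)),
      (fun i => t.1 (t.2.2.1 i), fun i => t.1 (t.2.2.2 i)))
  calc _ ≤ (Finset.univ.image F).card := by
        refine Finset.card_le_card fun Q hQ => ?_
        obtain ⟨g, hg⟩ := exists_comp_eq_of_card (Finset.mem_filter.1 hQ).2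
        have hmem : ∀ {n : ℕ} (x : Fin (n + 1) → Fin N) (i : Fin (n + 1)),
            x i ∈ (Finset.range (n + 1)).image (pathExt x) := fun x i =>
          Finset.mem_image.2 ⟨i, Finset.mem_range.2 i.2, pathExt_val x i⟩
        obtain ⟨h1, e1⟩ := hg _ Q.1.1 fun i => by
          simp only [doubleSupport, Finset.mem_union, hmem, true_or]
        obtain ⟨h2, e2⟩ := hg _ Q.1.2 fun i => by
          simp only [doubleSupport, Finset.mem_union, hmem, true_or, or_true]
        obtain ⟨h3, e3⟩ := hg _ Q.2.1 fun i => by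
          simp only [doubleSupport, Finset.mem_union, hmem, true_or, or_true]
        obtain ⟨h4, e4⟩ := hg _ Q.2.2 fun i => by
          simp only [doubleSupport, Finset.mem_union, hmem, or_true]
        refine Finset.mem_image.2 ⟨(g, (h1, h2), (h3, h4)), Finset.mem_univ _, ?_⟩
        simp only [F, e1, e2, e3, e4]
    _ ≤ _ := Finset.card_image_le
    _ = _ := by
        simp only [Finset.card_univ, Fintype.card_prod, Fintype.card_fun, Fintype.card_fin]
        ring

lemma card_filter_retraced_le (s : Finset (((Fin (l + 1) → Fin N) × (Fin (m + 1) → Fin N)) ×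
    ((Fin (l + 1) → Fin N) × (Fin (m + 1) → Fin N)))) :
    (s.filter fun Q => m = l ∧ (∀ i ≤ l, pathExt Q.1.2 i = pathExt Q.1.1 i) ∧
      ∀ i ≤ l, pathExt Q.2.2 i = pathExt Q.2.1 i).card ≤ N ^ (l + m + 2) := by
  rcases ne_or_eq m l with h | rfl
  · simp [h]
  have hext : ∀ (x y : Fin (m + 1) → Fin N), (∀ i ≤ m, pathExt y i = pathExt x i) → y = x :=
    fun x y h => funext fun i => by
      rw [← pathExt_val x, ← pathExt_val y, h i (Nat.lt_succ_iff.1 i.2)]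
  refine (Finset.card_le_card_of_injOn (fun Q => (Q.1.1, Q.2.1))
    (t := (Finset.univ : Finset ((Fin (m + 1) → Fin N) × (Fin (m + 1) → Fin N))))
    (fun _ _ => Finset.mem_univ _) ?_).trans ?_
  · rintro ⟨⟨x, y⟩, x', y'⟩ hQ ⟨⟨z, w⟩, z', w'⟩ hR h
    obtain ⟨-, -, h1, h2⟩ := Finset.mem_filter.1 hQ
    obtain ⟨-, -, h3, h4⟩ := Finset.mem_filter.1 hR
    obtain rfl : y = x := hext _ _ h1
    obtain rfl : y' = x' := hext _ _ h2
    obtain rfl : w = z := hext _ _ h3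
    obtain rfl : w' = z' := hext _ _ h4
    simp only [Prod.mk.injEq] at h
    obtain ⟨rfl, rfl⟩ := h
    rfl
  · simp only [Finset.card_univ, Fintype.card_prod, Fintype.card_fun, Fintype.card_fin]
    exact le_of_eq (by ring)

end Counting

section SecondMoment

variable {d N l m : ℕ} {p δ : ℝ} {I J : ℕ → Fin d}

lemma monomialMoment_doubleEdge_le (hp : 0 < p) (hp' : p ≤ 1) (hδ : 0 ≤ δ)
    (hIJ : m = l → (∀ i < l, J i = I i) → δ = 1) {x y x' y' : ℕ → Fin N}
    (hxy : x 0 = y 0) (hxy' : x' 0 = y' 0) :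
    monomialMoment p (doubleEdge l m I J x y x' y') (l + m + 2 + (l + m + 2)) ≤
      (if m = l ∧ (∀ i ≤ l, y i = x i) ∧ ∀ i ≤ l, y' i = x' i then δ * p ^ (l + m) else 0) +
        (p ^ 2)⁻¹ * (l + m + 2 + (l + m + 2)).factorial *
          ∑ v ∈ Finset.range (l + m + 2),
            if (doubleSupport l m x y x' y').card = v then p ^ v else 0 := by
  set ε := doubleEdge l m I J x y x' y' with hε
  set L := l + m + 2 + (l + m + 2) with hL
  have h1 : (0 : ℝ) ≤ if m = l ∧ (∀ i ≤ l, y i = x i) ∧ ∀ i ≤ l, y' i = x' i then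
      δ * p ^ (l + m) else 0 := by split_ifs <;> positivity
  have h2 : 0 ≤ (p ^ 2)⁻¹ * L.factorial * ∑ v ∈ Finset.range (l + m + 2),
      if (doubleSupport l m x y x' y').card = v then p ^ v else 0 :=
    mul_nonneg (by positivity) (Finset.sum_nonneg fun v _ => by split_ifs <;> positivity)
  rcases eq_or_ne (monomialMoment p ε L) 0 with h0 | h0
  · rw [h0]; positivity
  have heven := even_edgeCount_of_monomialMoment_ne_zero h0
  have hsupp : _ ≤ ((Finset.range L).image ε).card :=
    card_doubleSupport_le (l := l) (m := m) (I := I) (J := J) hxy hxy'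
  have hright : ((Finset.range L).filter fun k => (ε k).isRight).card ≤ 4 :=
    card_isRight_doubleEdge_le hxy hxy'
  have hvec := two_mul_numVectorEdges_le heven
  have hsum := numMatrixEdges_add_numVectorEdges (ε := ε) (L := L)
  rcases Nat.lt_or_ge (doubleSupport l m x y x' y').card (l + m + 2) with hv | hv
  · refine le_trans ?_ (le_add_of_nonneg_left h1)
    rw [Finset.sum_ite_eq, if_pos (Finset.mem_range.2 hv)]
    refine (monomialMoment_le hp.le).trans ?_
    have h3 : p ^ numMatrixEdges ε L * p ^ 2 ≤ p ^ (doubleSupport l m x y x' y').card := by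
      rw [← pow_add]
      exact pow_le_pow_of_le_one hp.le hp' (by lia)
    have h4 : p ^ numMatrixEdges ε L ≤ (p ^ 2)⁻¹ * p ^ (doubleSupport l m x y x' y').card := by
      rw [inv_mul_eq_div, le_div_iff₀ (by positivity)]
      exact h3
    calc _ ≤ (p ^ 2)⁻¹ * p ^ (doubleSupport l m x y x' y').card * L.factorial :=
          mul_le_mul_of_nonneg_right h4 (by positivity)
      _ = _ := by ring
  · obtain ⟨htwo, hml, hIJ', hy, hy'⟩ := double_ladder hxy hxy' heven hv
    refine le_trans ?_ (le_add_of_nonneg_right h2)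
    rw [if_pos ⟨hml, hy, hy'⟩, hIJ hml hIJ', one_mul, monomialMoment_eq_pow htwo]
    exact pow_le_pow_of_le_one hp.le hp' (by lia)

theorem integral_sq_pairSum_le (hp : 0 < p) (hp' : p ≤ 1) (hNp : 1 ≤ N * p) (hδ : 0 ≤ δ)
    (hIJ : m = l → (∀ i < l, J i = I i) → δ = 1) :
    ∫ ω, pairSum (N := N) l m I J ω ^ 2 ∂sparseMeasure d N p ≤
      δ * (N ^ 2 * (N * p) ^ (l + m)) + (p ^ 2)⁻¹ * (l + m + 2 + (l + m + 2)).factorial *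
        ((l + m + 2 : ℕ) ^ (l + m + 2 + (l + m + 2) + 1) * (N * p) ^ (l + m + 1)) := by
  rw [integral_sq_pairSum hp.le hp', ← Finset.sum_product']
  set s := rootedPairs l m N ×ˢ rootedPairs l m N
  refine (Finset.sum_le_sum fun Q hQ => monomialMoment_doubleEdge_le hp hp' hδ hIJ
    (eq_of_mem_rootedPairs (Finset.mem_product.1 hQ).1)
    (eq_of_mem_rootedPairs (Finset.mem_product.1 hQ).2)).trans ?_
  rw [Finset.sum_add_distrib, ← Finset.mul_sum, Finset.sum_comm]
  refine add_le_add ?_ (mul_le_mul_of_nonneg_left ?_ (by positivity))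
  · rw [← Finset.sum_filter, Finset.sum_const, nsmul_eq_mul]
    have h : ((s.filter fun Q => m = l ∧ (∀ i ≤ l, pathExt Q.1.2 i = pathExt Q.1.1 i) ∧
        ∀ i ≤ l, pathExt Q.2.2 i = pathExt Q.2.1 i).card : ℝ) ≤ N ^ (l + m + 2) := by
      exact_mod_cast card_filter_retraced_le s
    calc _ ≤ (N : ℝ) ^ (l + m + 2) * (δ * p ^ (l + m)) :=
          mul_le_mul_of_nonneg_right h (by positivity)
      _ = _ := by ring
  · have h : ∀ v ∈ Finset.range (l + m + 2),
        ∑ Q ∈ s, (if (doubleSupport l m (pathExt Q.1.1) (pathExt Q.1.2) (pathExt Q.2.1)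
          (pathExt Q.2.2)).card = v then p ^ v else 0) ≤
        (l + m + 2 : ℕ) ^ (l + m + 2 + (l + m + 2)) * (N * p) ^ (l + m + 1) := by
      intro v hv
      have hv' : v < l + m + 2 := Finset.mem_range.1 hv
      rw [← Finset.sum_filter, Finset.sum_const, nsmul_eq_mul]
      calc _ ≤ ((N : ℝ) ^ v * (v : ℝ) ^ (l + m + 2 + (l + m + 2))) * p ^ v :=
            mul_le_mul_of_nonneg_right (by exact_mod_cast card_filter_doubleSupport_le s v)
              (by positivity)
        _ = (v : ℝ) ^ (l + m + 2 + (l + m + 2)) * (N * p) ^ v := by ring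
        _ ≤ _ := by
            gcongr
            lia
    refine (Finset.sum_le_card_nsmul _ _ _ h).trans (le_of_eq ?_)
    rw [Finset.card_range, nsmul_eq_mul]
    ring

end SecondMoment

section FirstMoment

variable {d N l : ℕ} {p : ℝ} {I : ℕ → Fin d}

lemma edgeCount_chainEdge_self {D V : Type*} [DecidableEq D] [DecidableEq V] (I : ℕ → D)
    (x : ℕ → V) (e : (D × V × V) ⊕ V) : edgeCount (chainEdge l l I I x x) (l + l + 2) e =
      2 * edgeCount (pathEdge l I x) (l + 1) e := by
  rw [chainEdge, show l + l + 2 = (l + 1) + (l + 1) by lia, edgeCount_concatAt, two_mul]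
  congr 1
  simp only [edgeCount, Finset.card_filter]
  rw [← Finset.sum_range_reflect (fun k => if pathEdge l I x k = e then 1 else 0)]
  simp

lemma le_monomialMoment_chainEdge_self (hp : 0 ≤ p) (hp' : p ≤ 1) (x : ℕ → Fin N) :
    p ^ l ≤ monomialMoment p (chainEdge l l I I x x) (l + l + 2) := by
  have heven : ∀ e, Even (edgeCount (chainEdge l l I I x x) (l + l + 2) e) := fun e =>
    ⟨_, (edgeCount_chainEdge_self I x e).trans (two_mul _)⟩
  refine le_trans (pow_le_pow_of_le_one hp hp' ?_) (le_monomialMoment hp heven)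
  have h1 := two_mul_card_image_le heven
  have h2 := numMatrixEdges_add_numVectorEdges (ε := chainEdge l l I I x x) (L := l + l + 2)
  have h3 : 0 < numVectorEdges (chainEdge l l I I x x) (l + l + 2) := by
    refine Finset.card_pos.2 ⟨x l, Finset.mem_filter.2 ⟨Finset.mem_univ _, ?_⟩⟩
    refine edgeCount_pos_iff.2 (Finset.mem_image.2 ⟨0, by simp, ?_⟩)
    simp [chainEdge, concatAt, pathEdge]
  lia

theorem le_integral_pairSum_self (hp : 0 ≤ p) (hp' : p ≤ 1) :
    N * (N * p) ^ l ≤ ∫ ω, pairSum (N := N) l l I I ω ∂sparseMeasure d N p := by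
  rw [integral_pairSum hp hp']
  have hsub : Finset.univ.image (fun x : Fin (l + 1) → Fin N => (x, x)) ⊆ rootedPairs l l N := by
    intro q hq
    obtain ⟨x, -, rfl⟩ := Finset.mem_image.1 hq
    simp [rootedPairs]
  refine le_trans ?_ (Finset.sum_le_sum_of_subset_of_nonneg hsub
    fun _ _ _ => monomialMoment_nonneg hp)
  rw [Finset.sum_image fun x _ y _ h => (Prod.mk.inj h).1]
  refine le_trans (le_of_eq ?_)
    (Finset.card_nsmul_le_sum _ _ (p ^ l) fun x _ => le_monomialMoment_chainEdge_self hp hp' _)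
  simp only [Finset.card_univ, Fintype.card_fun, Fintype.card_fin, nsmul_eq_mul]
  push_cast
  ring

end FirstMoment

lemma factorial_mul_pow_le_sq_doubleFactorial (n : ℕ) :
    (n + 2 + (n + 2)).factorial * (n + 2) ^ (n + 2 + (n + 2) + 1) ≤
      (Nat.doubleFactorial (28 * n) * 30) ^ 2 := by
  rcases Nat.eq_zero_or_pos n with rfl | hn
  · decide
  have h1 : (7 * n + 1) ^ (7 * n) ≤ Nat.doubleFactorial (28 * n) := by
    rw [show 28 * n = 2 * (7 * n + 7 * n) by ring, Nat.doubleFactorial_two_mul]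
    calc (7 * n + 1) ^ (7 * n) ≤ (7 * n).factorial * (7 * n + 1) ^ (7 * n) :=
          Nat.le_mul_of_pos_left _ (Nat.factorial_pos _)
      _ ≤ (7 * n + 7 * n).factorial := Nat.factorial_mul_pow_le_factorial
      _ ≤ _ := Nat.le_mul_of_pos_left _ (by positivity)
  calc _ ≤ (n + 2 + (n + 2)) ^ (n + 2 + (n + 2)) * (n + 2) ^ (n + 2 + (n + 2) + 1) :=
        Nat.mul_le_mul_right _ (Nat.factorial_le_pow _)
    _ ≤ (7 * n + 1) ^ (n + 2 + (n + 2)) * (7 * n + 1) ^ (n + 2 + (n + 2) + 1) :=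
        Nat.mul_le_mul (Nat.pow_le_pow_left (by lia) _) (Nat.pow_le_pow_left (by lia) _)
    _ = (7 * n + 1) ^ (4 * n + 9) := by rw [← pow_add]; congr 1; ring
    _ ≤ (7 * n + 1) ^ (14 * n) := Nat.pow_le_pow_right (by lia) (by lia)
    _ = ((7 * n + 1) ^ (7 * n)) ^ 2 := by rw [← pow_mul]; congr 1; ring
    _ ≤ _ := Nat.pow_le_pow_left (h1.trans (Nat.le_mul_of_pos_right _ (by norm_num))) 2

theorem integral_sq_sub_wordDelta_le {d N : ℕ} (hd : 1 ≤ d) {p : ℝ} (hp : 0 < p)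
    (hp' : p ≤ 1) (hNp : 1 ≤ (N : ℝ) * p) (I J : List (Fin d)) :
    ∫ ω, ((N : ℝ)⁻¹ * (sparseFeature p I ω ⬝ᵥ sparseFeature p J ω) - wordDelta I J) ^ 2
        ∂(sparseMeasure d N p) ≤
      (I.length + J.length + 2 + (I.length + J.length + 2)).factorial *
        (I.length + J.length + 2 : ℕ) ^ (I.length + J.length + 2 + (I.length + J.length + 2) + 1) /
          (N * p) := by
  have hN : (0 : ℝ) < N := pos_of_mul_pos_left (one_pos.trans_le hNp) hp.le
  have hq : (0 : ℝ) < N * p := one_pos.trans_le hNp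
  let z : Fin d := ⟨0, hd⟩
  set l := I.length
  set m := J.length
  set δ := wordDelta I J
  set s := (Real.sqrt (N * p))⁻¹
  have hs : s ^ 2 = (N * p)⁻¹ := by rw [inv_pow, Real.sq_sqrt hq.le]
  have := isProbabilityMeasure_bernoulliReal hp.le hp'
  have : IsProbabilityMeasure (sparseMeasure d N p) := by unfold sparseMeasure; infer_instance
  set T : SparseOmega d N → ℝ := pairSum l m (wordExt z I) (wordExt z J)
  have h1 : Integrable T (sparseMeasure d N p) := integrable_pairSum hp.le hp' _ _
  have h2 : Integrable (fun ω => T ω ^ 2) (sparseMeasure d N p) :=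
    integrable_sq_pairSum hp.le hp' _ _
  have hexp : ∫ ω, ((N : ℝ)⁻¹ * (sparseFeature p I ω ⬝ᵥ sparseFeature p J ω) - δ) ^ 2
      ∂(sparseMeasure d N p) = (N ^ 2 * (N * p) ^ (l + m))⁻¹ * ∫ ω, T ω ^ 2 ∂sparseMeasure d N p -
        2 * δ * (N : ℝ)⁻¹ * s ^ (l + m) * ∫ ω, T ω ∂sparseMeasure d N p + δ ^ 2 := by
    have hpt : ∀ ω, ((N : ℝ)⁻¹ * (sparseFeature p I ω ⬝ᵥ sparseFeature p J ω) - δ) ^ 2 =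
        (N ^ 2 * (N * p) ^ (l + m))⁻¹ * T ω ^ 2 - 2 * δ * (N : ℝ)⁻¹ * s ^ (l + m) * T ω +
          δ ^ 2 := by
      intro ω
      rw [dotProduct_sparseFeature z, mul_inv, ← inv_pow (N * p : ℝ), ← hs]
      ring
    simp only [hpt]
    have h3 : Integrable (fun ω => (N ^ 2 * (N * p) ^ (l + m))⁻¹ * T ω ^ 2 -
        2 * δ * (N : ℝ)⁻¹ * s ^ (l + m) * T ω) (sparseMeasure d N p) :=
      (h2.const_mul _).sub (h1.const_mul _)
    rw [integral_add h3 (integrable_const _), integral_sub (h2.const_mul _) (h1.const_mul _),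
      integral_const_mul, integral_const_mul]
    simp
  have hδ : 0 ≤ δ := by simp only [δ, wordDelta]; split_ifs <;> norm_num
  have hsq := integral_sq_pairSum_le (N := N) (l := l) (m := m) (I := wordExt z I)
    (J := wordExt z J) hp hp' hNp hδ fun hl h => if_pos (wordExt_injective z hl h)
  have hlow : δ ≤ δ * ((N : ℝ)⁻¹ * s ^ (l + m) * ∫ ω, T ω ∂sparseMeasure d N p) := by
    by_cases hIJ : I = J
    · refine le_mul_of_one_le_right hδ ?_
      subst hIJ
      have h3 := mul_le_mul_of_nonneg_left (le_integral_pairSum_self (N := N) (l := l)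
        (I := wordExt z I) hp.le hp') (by positivity : 0 ≤ (N : ℝ)⁻¹ * s ^ (l + l))
      refine le_trans (le_of_eq ?_) h3
      rw [← two_mul, pow_mul, hs, inv_pow, mul_mul_mul_comm, inv_mul_cancel₀ hN.ne',
        inv_mul_cancel₀ (pow_pos hq l).ne', one_mul]
    · simp [δ, wordDelta, hIJ]
  have hup := mul_le_mul_of_nonneg_left hsq
    (by positivity : 0 ≤ ((N : ℝ) ^ 2 * (N * p) ^ (l + m))⁻¹)
  rw [hexp]
  have hδ2 : δ ^ 2 = δ := by simp only [δ, wordDelta]; split_ifs <;> norm_num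
  refine le_trans (b := (N ^ 2 * (N * p) ^ (l + m))⁻¹ * ∫ ω, T ω ^ 2 ∂sparseMeasure d N p - δ)
    (by rw [hδ2]; linarith) ?_
  rw [sub_le_iff_le_add]
  refine hup.trans (le_of_eq ?_)
  field_simp
  ring

/-- **Key moment bound for the sparse model.**  There are universal constants `κ ≥ 1`
and `c > 0` such that for all `d, N ≥ 1`, every sparsity `p ∈ (0,1]` with `N⬝p ≥ 1`,
and all words `I, J` over `{1,…,d}`,
`E[((1/N)⟨A_I h₀, A_J h₀⟩ - δ_{I,J})²]^{1/2} ≤ (κ(|I|+|J|))!! ⬝ c / √(Np)`. -/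
theorem sparse_moment_bound :
    ∃ (κ : ℕ) (c : ℝ), 1 ≤ κ ∧ 0 < c ∧
      ∀ (d N : ℕ), 1 ≤ d → 1 ≤ N →
        ∀ p : ℝ, 0 < p → p ≤ 1 → 1 ≤ (N : ℝ) * p →
          ∀ (I J : List (Fin d)),
            Real.sqrt (∫ ω, (((N : ℕ) : ℝ)⁻¹ *
                  (sparseFeature p I ω ⬝ᵥ sparseFeature p J ω) - wordDelta I J) ^ 2
                ∂(sparseMeasure d N p))
              ≤ (Nat.doubleFactorial (κ * (I.length + J.length)) : ℝ)
                  * (c / Real.sqrt ((N : ℝ) * p)) := by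
  refine ⟨28, 30, by norm_num, by norm_num, fun d N hd _ p hp hp' hNp I J => ?_⟩
  have hq : (0 : ℝ) < N * p := one_pos.trans_le hNp
  refine Real.sqrt_le_iff.2 ⟨by positivity, ?_⟩
  refine (integral_sq_sub_wordDelta_le hd hp hp' hNp I J).trans ?_
  rw [← mul_div_assoc, div_pow, Real.sq_sqrt hq.le]
  gcongr
  exact_mod_cast factorial_mul_pow_le_sq_doubleFactorial (I.length + J.length)

end
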